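/- Suppose f is a slice regular self-map of 𝔹 which is not of the form ℳ_{p'} u with p' ∈ 𝔹 and |u| = 1, and fix p ∈ 𝔹. Then f⋆_p is of the form ℳ_{p''} v for some p'' ∈ 𝔹 and v ∈ ℍ with |v| = 1 if and only if f is a regular Blaschke product of degree 2. -/

import Mathlib

noncomputable section

abbrev H : Type := Quaternion ℝ

namespace QPaper

/-- The complex slice determined by `I`: the real span of `1` and `I`. -/
def sliceSet (I : H) : Set H := {q | ∃ x y : ℝ, q = (x : H) + y • I}

/-- Evaluation of the power series `q ↦ ∑ qᵐ aₘ` with right coefficients. -/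
def evalC (a : ℕ → H) (q : H) : H := ∑' m, q ^ m * a m

/-- The series with coefficients `a` converges at every point of the unit ball. -/
def SummableOn (a : ℕ → H) : Prop := ∀ q : H, ‖q‖ < 1 → Summable fun m => q ^ m * a m

/-- `a` are the coefficients of a slice regular self-map of the unit ball. -/
def SelfMap (a : ℕ → H) : Prop :=
  SummableOn a ∧ ∀ q : H, ‖q‖ < 1 → ‖evalC a q‖ < 1

/-- Coefficients of the ∗-product. -/
def starMulC (a b : ℕ → H) : ℕ → H := fun m => ∑ ℓ ∈ Finset.range (m + 1), a (m - ℓ) * b ℓ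

/-- Coefficients of the ∗-inverse (of a series with invertible constant term). -/
def starInvC (a : ℕ → H) : ℕ → H
  | 0 => (a 0)⁻¹
  | m + 1 => -(a 0)⁻¹ * ∑ ℓ : Fin (m + 1), a (m + 1 - ℓ.val) * starInvC a ℓ.val
  decreasing_by exact ℓ.isLt

/-- Coefficients of `1 - q p̄`. -/
def oneMinusQPbarC (p : H) : ℕ → H := fun m => if m = 0 then 1 else if m = 1 then -(star p) else 0

/-- Coefficients of `q - p`. -/
def qMinusPC (p : H) : ℕ → H := fun m => if m = 0 then -p else if m = 1 then 1 else 0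

/-- Coefficients of the regular Möbius transformation `ℳ_p = (1 - q p̄)^{-∗} ∗ (q - p)`. -/
def mobiusC (p : H) : ℕ → H := starMulC (starInvC (oneMinusQPbarC p)) (qMinusPC p)

/-- Coefficients of `ℳ_{t₁} ∗ ⋯ ∗ ℳ_{t_κ}`. -/
def blaschkeListC : List H → (ℕ → H)
  | [] => fun m => if m = 0 then 1 else 0
  | t :: ts => starMulC (mobiusC t) (blaschkeListC ts)

/-- `a` are the coefficients of a regular Blaschke product of degree `κ`,
i.e. of `ℳ_{t₁} ∗ ⋯ ∗ ℳ_{t_κ} u` with the `tᵢ` in `𝔹` and `u` unimodular. -/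
def IsBlaschke (a : ℕ → H) (κ : ℕ) : Prop :=
  ∃ (ts : List H) (u : H), ts.length = κ ∧ (∀ t ∈ ts, ‖t‖ < 1) ∧ ‖u‖ = 1 ∧
    a = fun m => blaschkeListC ts m * u

/-- Coefficients of `ℳ_w ∙ f = (1 - f w̄)^{-∗} ∗ (f - w)`. -/
def bulletC (w : H) (a : ℕ → H) : ℕ → H :=
  starMulC (starInvC (fun m => (if m = 0 then (1 : H) else 0) - a m * star w))
    (fun m => a m - if m = 0 then w else 0)

/-- Coefficients of the regular difference quotient `ℛ_{f,p}`,
the unique slice regular function with `f(q) = f(p) + (q - p) ∗ ℛ_{f,p}(q)`. -/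
def diffQuotC (a : ℕ → H) (p : H) : ℕ → H := fun m => ∑' k, p ^ k * a (k + m + 1)

/-- Coefficients of the hyperbolic difference quotient
`f⋆_p = (1 - q p̄) ∗ ℛ_{f,p} ∗ (1 - \overline{f(p)} f)^{-∗} = ℳ_p^{-∗} ∗ (ℳ_{f(p)} ∙ f)`. -/
def hdqC (a : ℕ → H) (p : H) : ℕ → H :=
  starMulC (starMulC (oneMinusQPbarC p) (diffQuotC a p))
    (starInvC (fun m => (if m = 0 then (1 : H) else 0) - star (evalC a p) * a m))

/-- Iterated hyperbolic difference quotients: `ihdqC a [p₁, …, pₙ] = ((f⋆_{p₁})⋆_{p₂} ⋯)⋆_{pₙ}`. -/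
def ihdqC (a : ℕ → H) : List H → (ℕ → H)
  | [] => a
  | p :: ps => ihdqC (hdqC a p) ps

/-- `𝒯_p(q) = (1 - q p)⁻¹ q (1 - q p)`. -/
def mobiusT (p q : H) : H := (1 - q * p)⁻¹ * q * (1 - q * p)

/-- `M_p(q) = (1 - q p̄)⁻¹ (q - p)`. -/
def mobiusM (p q : H) : H := (1 - q * star p)⁻¹ * (q - p)

/-- Pointwise evaluation of the regular Möbius transformation: `ℳ_p(q) = M_p(𝒯_p(q))`. -/
def mobiusEval (p q : H) : H := mobiusM p (mobiusT p q)

/-- The pseudo-hyperbolic distance `ρ(p,q) = |M_p(q)|`. -/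
def rho (p q : H) : ℝ := ‖mobiusM p q‖

/-- The Poincaré distance `δ(p,q) = tanh⁻¹ ρ(p,q) = ½ log((1+ρ)/(1−ρ))`. -/
def pdist (p q : H) : ℝ := (1/2 : ℝ) * Real.log ((1 + rho p q) / (1 - rho p q))


open PowerSeries in
lemma mk_starMulC (a b : ℕ → H) : PowerSeries.mk (starMulC a b) = PowerSeries.mk a * PowerSeries.mk b := by
  ext1 n
  rw [PowerSeries.coeff_mul, PowerSeries.coeff_mk, ← Finset.Nat.sum_antidiagonal_swap,
    Finset.Nat.sum_antidiagonal_eq_sum_range_succ_mk]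
  simp [starMulC]

lemma mk_inj {a b : ℕ → H} (h : PowerSeries.mk a = PowerSeries.mk b) : a = b := by
  funext n
  have := congrArg (PowerSeries.coeff n) h
  simpa using this

lemma mul_starInvC (a : ℕ → H) (h : a 0 ≠ 0) :
    PowerSeries.mk a * PowerSeries.mk (starInvC a) = 1 := by
  rw [← mk_starMulC]
  ext1 n
  rw [PowerSeries.coeff_mk, PowerSeries.coeff_one]
  cases n with
  | zero => simp [starMulC, starInvC, h]
  | succ m =>
    rw [starMulC, Finset.sum_range_succ, starInvC, Finset.sum_range]
    simp [← mul_assoc, h]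

lemma starInvC_mul (a : ℕ → H) (h : a 0 ≠ 0) :
    PowerSeries.mk (starInvC a) * PowerSeries.mk a = 1 := by
  have h1 := mul_starInvC a h
  have h0 : PowerSeries.mk a ≠ 0 := by
    intro h0
    rw [h0, zero_mul] at h1
    exact zero_ne_one h1
  apply mul_left_cancel₀ h0
  rw [← mul_assoc, h1, one_mul, mul_one]

/-- linear polynomial -/
def lin (a b : H) : PowerSeries H := PowerSeries.mk fun m => if m = 0 then a else if m = 1 then b else 0

/-- quadratic polynomial -/
def quad (a b c : H) : PowerSeries H :=
  PowerSeries.mk fun m => if m = 0 then a else if m = 1 then b else if m = 2 then c else 0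

lemma lin_eq (a b : H) : lin a b = PowerSeries.C a + PowerSeries.X * PowerSeries.C b := by
  ext1 n
  rcases n with _ | _ | n <;> simp [lin, PowerSeries.coeff_succ_X_mul, PowerSeries.coeff_X]

lemma quad_eq (a b c : H) : quad a b c = PowerSeries.C a + PowerSeries.X * (PowerSeries.C b +
    PowerSeries.X * PowerSeries.C c) := by
  ext1 n
  rcases n with _ | _ | _ | n <;> simp [quad, PowerSeries.coeff_succ_X_mul, PowerSeries.coeff_X]

lemma lin_mul_lin (a b c d : H) : lin a b * lin c d = quad (a * c) (a * d + b * c) (b * d) := by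
  have hX : ∀ f : PowerSeries H, f * PowerSeries.X = PowerSeries.X * f :=
    fun f => (PowerSeries.commute_X f).eq
  have h1 : ∀ f g : PowerSeries H, f * (PowerSeries.X * g) = PowerSeries.X * (f * g) := fun f g => by
    rw [← mul_assoc, hX, mul_assoc]
  rw [lin_eq, lin_eq, quad_eq]
  simp only [map_add, map_mul, add_mul, mul_add, h1, mul_assoc]
  abel

lemma lin_zero_right (a : H) : lin a 0 = PowerSeries.C a := by simp [lin_eq]

lemma quad_mul_C (a b c u : H) : quad a b c * PowerSeries.C u = quad (a*u) (b*u) (c*u) := by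
  simp [quad_eq, add_mul, mul_assoc, mul_add]

lemma lin_mul_C (a b u : H) : lin a b * PowerSeries.C u = lin (a*u) (b*u) := by
  simp [lin_eq, add_mul, mul_assoc, mul_add]

lemma quad_add (a b c a' b' c' : H) : quad a b c + quad a' b' c' = quad (a+a') (b+b') (c+c') := by
  simp only [quad_eq, map_add, mul_add]; abel

lemma coeff_lin_zero (a b : H) (f : PowerSeries H) :
    PowerSeries.coeff 0 (lin a b * f) = a * PowerSeries.coeff 0 f := by
  simp [lin_eq, add_mul, mul_assoc]

lemma lin_ne_zero {a b : H} (h : a ≠ 0 ∨ b ≠ 0) : lin a b ≠ 0 := by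
  intro h0
  have h1 := congrArg (PowerSeries.coeff 0) h0
  have h2 := congrArg (PowerSeries.coeff 1) h0
  simp [lin] at h1 h2
  tauto

lemma quad_ne_zero {a b c : H} (h : a ≠ 0) : quad a b c ≠ 0 := by
  intro h0
  have h1 := congrArg (PowerSeries.coeff 0) h0
  simp [quad] at h1
  tauto

lemma quad_coeffs {d0 d1 d2 n0 n1 n2 : H} {a : ℕ → H}
    (h : quad d0 d1 d2 * PowerSeries.mk a = quad n0 n1 n2) :
    d0 * a 0 = n0 ∧ d0 * a 1 + d1 * a 0 = n1 ∧ d0 * a 2 + d1 * a 1 + d2 * a 0 = n2 ∧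
    ∀ m, d0 * a (m+3) + d1 * a (m+2) + d2 * a (m+1) = 0 := by
  have key : ∀ n, PowerSeries.coeff n (quad d0 d1 d2 * PowerSeries.mk a) = PowerSeries.coeff n (quad n0 n1 n2) := by
    rw [h]; simp
  rw [quad_eq] at key
  simp only [add_mul, mul_assoc, mul_add] at key
  have k0 := key 0
  have k1 := key 1
  have k2 := key 2
  simp [quad, PowerSeries.coeff_succ_X_mul] at k0
  rw [show (1:ℕ) = 0 + 1 from rfl] at k1
  rw [show (2:ℕ) = 0 + 1 + 1 from rfl] at k2
  simp [quad, PowerSeries.coeff_succ_X_mul] at k1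
  simp [-zero_add, quad, PowerSeries.coeff_succ_X_mul] at k2
  refine ⟨k0, k1, by rw [← k2]; abel, fun m => ?_⟩
  have k3 := key (m+1+1+1)
  simp [quad, PowerSeries.coeff_succ_X_mul] at k3
  rw [← k3]; abel

lemma mk_oneMinus (p : H) : PowerSeries.mk (oneMinusQPbarC p) = lin 1 (-(star p)) := rfl
lemma mk_qMinus (p : H) : PowerSeries.mk (qMinusPC p) = lin (-p) 1 := rfl

lemma mobius_eq (p : H) : lin 1 (-(star p)) * PowerSeries.mk (mobiusC p) = lin (-p) 1 := by
  rw [mobiusC, mk_starMulC, ← mul_assoc, ← mk_oneMinus, mul_starInvC, one_mul, mk_qMinus]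
  simp [oneMinusQPbarC]

lemma lin_comm (p : H) : lin 1 (-(star p)) * lin (-p) 1 = lin (-p) 1 * lin 1 (-(star p)) := by
  rw [lin_mul_lin, lin_mul_lin]
  congr 1 <;> simp [Quaternion.self_mul_star, Quaternion.star_mul_self]
  abel

lemma mk_one : PowerSeries.mk (fun m => if m = 0 then (1:H) else 0) = 1 := by
  ext1 n; simp [PowerSeries.coeff_one]

lemma mk_mul_const (b : ℕ → H) (u : H) :
    PowerSeries.mk (fun m => b m * u) = PowerSeries.mk b * PowerSeries.C u := by
  ext1 n; simp

lemma mk_const_mul (b : ℕ → H) (u : H) :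
    PowerSeries.mk (fun m => u * b m) = PowerSeries.C u * PowerSeries.mk b := by
  ext1 n; simp

lemma blaschke1_iff (a : ℕ → H) : IsBlaschke a 1 ↔ ∃ t u : H, ‖t‖ < 1 ∧ ‖u‖ = 1 ∧
    lin 1 (-(star t)) * PowerSeries.mk a = lin (-t) 1 * PowerSeries.C u := by
  constructor
  · rintro ⟨ts, u, hl, ht, hu, rfl⟩
    obtain ⟨t, rfl⟩ := List.length_eq_one_iff.1 hl
    refine ⟨t, u, by simpa using ht, hu, ?_⟩
    rw [mk_mul_const, blaschkeListC, mk_starMulC, blaschkeListC, mk_one, mul_one, ← mul_assoc, mobius_eq]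
  · rintro ⟨t, u, ht, hu, h⟩
    refine ⟨[t], u, rfl, by simpa using ht, hu, mk_inj ?_⟩
    rw [mk_mul_const, blaschkeListC, mk_starMulC, blaschkeListC, mk_one, mul_one]
    apply mul_left_cancel₀ (lin_ne_zero (a := 1) (b := -(star t)) (by simp))
    rw [h, ← mul_assoc, mobius_eq]

lemma blaschke2_iff (a : ℕ → H) : IsBlaschke a 2 ↔ ∃ (p : H) (g : ℕ → H), ‖p‖ < 1 ∧ IsBlaschke g 1 ∧
    lin 1 (-(star p)) * PowerSeries.mk a = lin (-p) 1 * PowerSeries.mk g := by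
  constructor
  · rintro ⟨ts, u, hl, ht, hu, rfl⟩
    obtain ⟨t, s, rfl⟩ := List.length_eq_two.1 hl
    refine ⟨t, fun m => blaschkeListC [s] m * u, by simp at ht; tauto, ⟨[s], u, rfl, by simp at ht ⊢; tauto, hu, rfl⟩, ?_⟩
    rw [mk_mul_const, blaschkeListC, mk_starMulC, ← mul_assoc, ← mul_assoc, mobius_eq, mk_mul_const, mul_assoc]
  · rintro ⟨p, g, hp, ⟨ts, u, hl, ht, hu, rfl⟩, h⟩
    obtain ⟨t, rfl⟩ := List.length_eq_one_iff.1 hl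
    refine ⟨[p, t], u, rfl, by simp at ht ⊢; tauto, hu, mk_inj ?_⟩
    rw [mk_mul_const, blaschkeListC, mk_starMulC]
    apply mul_left_cancel₀ (lin_ne_zero (a := 1) (b := -(star p)) (by simp))
    rw [h, ← mul_assoc, ← mul_assoc, mobius_eq, mk_mul_const, mul_assoc]

lemma conj_pow' {y x : H} (hy : y ≠ 0) (m : ℕ) : (y⁻¹ * x * y) ^ m = y⁻¹ * x ^ m * y := by
  induction m with
  | zero => simp [hy]
  | succ m ih =>
    rw [pow_succ, ih, pow_succ]
    calc y⁻¹ * x ^ m * y * (y⁻¹ * x * y) = y⁻¹ * x ^ m * (y * y⁻¹) * x * y := by simp only [mul_assoc]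
      _ = _ := by rw [mul_inv_cancel₀ hy]; simp only [mul_assoc, mul_one, one_mul]

lemma norm_conj {y x : H} (hy : y ≠ 0) : ‖y⁻¹ * x * y‖ = ‖x‖ := by
  have : ‖y‖ ≠ 0 := by simpa using hy
  rw [norm_mul, norm_mul, norm_inv]; field_simp

lemma hasSum_conj {a : ℕ → H} (ha : SummableOn a) {x y : H} (hx : ‖x‖ < 1) (hy : y ≠ 0) :
    HasSum (fun m => x ^ m * (y * a m)) (y * evalC a (y⁻¹ * x * y)) := by
  have h := (ha (y⁻¹ * x * y) (by rwa [norm_conj hy])).hasSum.mul_left y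
  have e : (fun m => x ^ m * (y * a m)) = fun m => y * ((y⁻¹ * x * y) ^ m * a m) := by
    funext m
    rw [conj_pow' hy]
    simp only [← mul_assoc, mul_inv_cancel₀ hy, one_mul]
  rw [e]
  exact h

lemma summable_conj {a : ℕ → H} (ha : SummableOn a) {x : H} (hx : ‖x‖ < 1) (y : H) :
    Summable (fun m => x ^ m * (y * a m)) := by
  by_cases hy : y = 0
  · simp [hy, summable_zero]
  · exact (hasSum_conj ha hx hy).summable

lemma eval_quad_tsum {a : ℕ → H} (ha : SummableOn a) {d0 d1 d2 n0 n1 n2 : H}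
    (h : quad d0 d1 d2 * PowerSeries.mk a = quad n0 n1 n2) {x : H} (hx : ‖x‖ < 1) :
    ∑' m, x ^ m * ((d0 + x * d1 + x * x * d2) * a m) = n0 + x * n1 + x * x * n2 := by
  obtain ⟨h0, h1, h2, h3⟩ := quad_coeffs h
  have e0 := (summable_conj ha hx d0).hasSum
  have e1 := (summable_conj ha hx d1).hasSum
  have e2 := (summable_conj ha hx d2).hasSum
  have s0 := (summable_conj ha hx d0).sum_add_tsum_nat_add 3
  have s1 := (summable_conj ha hx d1).sum_add_tsum_nat_add 2
  have s2 := (summable_conj ha hx d2).sum_add_tsum_nat_add 1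
  have f0 := ((summable_nat_add_iff 3).2 (summable_conj ha hx d0))
  have f1 := ((summable_nat_add_iff 2).2 (summable_conj ha hx d1))
  have f2 := ((summable_nat_add_iff 1).2 (summable_conj ha hx d2))
  have tot : ∑' m, x ^ m * ((d0 + x * d1 + x * x * d2) * a m) =
      ∑' m, x ^ m * (d0 * a m) + x * ∑' m, x ^ m * (d1 * a m) + x * x * ∑' m, x ^ m * (d2 * a m) := by
    rw [← ((e0.add (e1.mul_left x)).add (e2.mul_left (x*x))).tsum_eq]
    congr 1; funext m
    have c1 : x ^ m * (x * (d1 * a m)) = x * (x ^ m * (d1 * a m)) := by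
      rw [← mul_assoc, ← mul_assoc, (Commute.pow_self x m).eq]; simp only [mul_assoc]
    have c2 : x ^ m * (x * x * (d2 * a m)) = x * x * (x ^ m * (d2 * a m)) := by
      rw [← mul_assoc, ← mul_assoc, ((Commute.pow_self x m).mul_right (Commute.pow_self x m)).eq]; simp only [mul_assoc]
    rw [← c1, ← c2]
    simp only [add_mul, mul_add, mul_assoc]
  have z : ∑' m, x ^ (m+3) * (d0 * a (m+3)) + x * ∑' m, x ^ (m+2) * (d1 * a (m+2))
      + x * x * ∑' m, x ^ (m+1) * (d2 * a (m+1)) = 0 := by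
    have := ((f0.hasSum.add (f1.hasSum.mul_left x)).add (f2.hasSum.mul_left (x*x))).tsum_eq
    rw [← this]
    convert tsum_zero with m
    have : x ^ (m+3) * (d0 * a (m+3)) + x * (x ^ (m+2) * (d1 * a (m+2))) + x * x * (x ^ (m+1) * (d2 * a (m+1)))
      = x ^ (m+3) * (d0 * a (m+3) + d1 * a (m+2) + d2 * a (m+1)) := by
      rw [pow_succ' x (m+2), pow_succ' x (m+1)]
      simp only [mul_add, mul_assoc]
    rw [this, h3, mul_zero]
  rw [tot, ← s0, ← s1, ← s2]
  simp only [Finset.sum_range_succ, Finset.sum_range_zero, zero_add, pow_zero, pow_one, one_mul]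
  rw [← h0, ← h1, ← h2]
  generalize ∑' m, x ^ (m+3) * (d0 * a (m+3)) = A at z ⊢
  generalize ∑' m, x ^ (m+2) * (d1 * a (m+2)) = B at z ⊢
  generalize ∑' m, x ^ (m+1) * (d2 * a (m+1)) = E at z ⊢
  have hA : A = -(x * B + x * x * E) := by rw [← sub_eq_zero, ← z]; abel
  rw [hA]
  simp only [mul_add, pow_two, mul_assoc]
  abel

lemma eval_quad {a : ℕ → H} (ha : SummableOn a) {d0 d1 d2 n0 n1 n2 : H}
    (h : quad d0 d1 d2 * PowerSeries.mk a = quad n0 n1 n2) {x : H} (hx : ‖x‖ < 1)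
    (hy : d0 + x * d1 + x * x * d2 ≠ 0) :
    n0 + x * n1 + x * x * n2 = (d0 + x * d1 + x * x * d2) *
      evalC a ((d0 + x * d1 + x * x * d2)⁻¹ * x * (d0 + x * d1 + x * x * d2)) := by
  rw [← eval_quad_tsum ha h hx, (hasSum_conj ha hx hy).tsum_eq]

lemma eval_quad_zero {a : ℕ → H} (ha : SummableOn a) {d0 d1 d2 n0 n1 n2 : H}
    (h : quad d0 d1 d2 * PowerSeries.mk a = quad n0 n1 n2) {x : H} (hx : ‖x‖ < 1)
    (hy : d0 + x * d1 + x * x * d2 = 0) : n0 + x * n1 + x * x * n2 = 0 := by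
  rw [← eval_quad_tsum ha h hx, hy]; simp

lemma summable_shift {a : ℕ → H} (ha : SummableOn a) {p : H} (hp : ‖p‖ < 1) (m : ℕ) :
    Summable fun k => p ^ k * a (k + m) := by
  by_cases h0 : p = 0
  · apply summable_of_ne_finset_zero (s := {0})
    intro b hb
    have : b ≠ 0 := by simpa using hb
    simp [h0, this]
  · have := ((summable_nat_add_iff m).2 (ha p hp)).mul_left ((p ^ m)⁻¹)
    refine this.congr fun k => ?_
    rw [add_comm k m, pow_add, ← mul_assoc, ← mul_assoc, inv_mul_cancel₀ (pow_ne_zero _ h0), one_mul]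

lemma diffQuot_step {a : ℕ → H} (ha : SummableOn a) {p : H} (hp : ‖p‖ < 1) (m : ℕ) :
    ∑' k, p ^ k * a (k + m) = a m + p * ∑' k, p ^ k * a (k + m + 1) := by
  have e : ∀ k, a (k + m + 1) = a (k + (m + 1)) := fun k => by rw [add_assoc]
  simp only [e]
  rw [(summable_shift ha hp m).tsum_eq_zero_add, ← Summable.tsum_mul_left p (summable_shift ha hp (m+1))]
  simp only [pow_zero, one_mul, zero_add]
  congr 2; funext k
  rw [pow_succ', mul_assoc]; congr 3; ring

lemma diffQuot_eq {a : ℕ → H} (ha : SummableOn a) {p : H} (hp : ‖p‖ < 1) :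
    lin (-p) 1 * PowerSeries.mk (diffQuotC a p) = PowerSeries.mk a - PowerSeries.C (evalC a p) := by
  rw [lin_eq]
  ext1 n
  have h0 := diffQuot_step ha hp n
  simp only [add_mul, map_one, mul_one]
  rcases n with _ | n
  · simp [diffQuotC, evalC] at h0 ⊢
    rw [h0]; abel
  · simp [diffQuotC, PowerSeries.coeff_succ_X_mul, PowerSeries.coeff_C] at h0 ⊢
    simp only [← add_assoc] at h0 ⊢
    rw [h0]; abel

lemma one_sub_ne {x y : H} (hx : ‖x‖ < 1) (hy : ‖y‖ ≤ 1) : 1 - x * y ≠ 0 := by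
  intro h
  have h1 : ‖x * y‖ = 1 := by rw [← sub_eq_zero.1 h]; simp
  rw [norm_mul] at h1
  nlinarith [norm_nonneg x, norm_nonneg y]

/-- basic factorization of the hyperbolic difference quotient -/
lemma hdq_eq {a : ℕ → H} (ha : SelfMap a) {p : H} (hp : ‖p‖ < 1) :
    lin (-p) 1 * PowerSeries.mk (hdqC a p) * (1 - PowerSeries.C (star (evalC a p)) * PowerSeries.mk a)
      = lin 1 (-(star p)) * (PowerSeries.mk a - PowerSeries.C (evalC a p)) := by
  have h0 : ‖a 0‖ < 1 := by
    have := ha.2 0 (by simp)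
    rwa [evalC, tsum_eq_single 0 (by intro m hm; simp [hm]), pow_zero, one_mul] at this
  have e : PowerSeries.mk (fun m => (if m = 0 then (1 : H) else 0) - star (evalC a p) * a m)
      = 1 - PowerSeries.C (star (evalC a p)) * PowerSeries.mk a := by
    rw [← mk_one, ← mk_const_mul]; rfl
  rw [hdqC, mk_starMulC, mk_starMulC, mk_oneMinus, ← e, mul_assoc, mul_assoc _ (PowerSeries.mk (starInvC _)),
    starInvC_mul, mul_one, ← diffQuot_eq ha.1 hp, ← mul_assoc, ← mul_assoc, lin_comm]
  simp only [if_true]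
  exact one_sub_ne (by rw [norm_star]; exact ha.2 p hp) h0.le

lemma norm_a0 {a : ℕ → H} (ha : SelfMap a) : ‖a 0‖ < 1 := by
  have := ha.2 0 (by simp)
  rwa [evalC, tsum_eq_single 0 (by intro m hm; simp [hm]), pow_zero, one_mul] at this

lemma nsq (x : H) : x * star x = ((‖x‖^2 : ℝ) : H) := by
  rw [Quaternion.self_mul_star, Quaternion.normSq_eq_norm_mul_self, sq]
lemma nsq' (x : H) : star x * x = ((‖x‖^2 : ℝ) : H) := by
  rw [Quaternion.star_mul_self, Quaternion.normSq_eq_norm_mul_self, sq]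

lemma unit_star {u : H} (hu : ‖u‖ = 1) : u * star u = 1 := by rw [nsq, hu]; simp
lemma unit_star' {u : H} (hu : ‖u‖ = 1) : star u * u = 1 := by rw [nsq', hu]; simp

lemma deg1 {h : ℕ → H} {k0 k1 m0 m1 : H} (hE : lin k0 k1 * PowerSeries.mk h = lin m0 m1)
    (z0 : k0 * star k1 = m0 * star m1)
    (z1 : k0 * star k0 + k1 * star k1 = m0 * star m0 + m1 * star m1) (hk : k0 ≠ 0)
    (hle : ‖k1‖ ≤ ‖k0‖) : IsBlaschke h 1 ∨ ∃ v : H, ‖v‖ = 1 ∧ PowerSeries.mk h = PowerSeries.C v := by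
  have r0 : ‖k0‖ * ‖k1‖ = ‖m0‖ * ‖m1‖ := by
    have := congrArg norm z0; simpa [norm_mul] using this
  have r1 : ‖k0‖^2 + ‖k1‖^2 = ‖m0‖^2 + ‖m1‖^2 := by
    rw [nsq, nsq, nsq, nsq, ← Quaternion.coe_add, ← Quaternion.coe_add] at z1
    exact Quaternion.coe_injective z1
  have hk' : 0 < ‖k0‖ := by simpa using hk
  have hlin : lin k0 k1 ≠ 0 := lin_ne_zero (Or.inl hk)
  have r2 : (‖k0‖^2 - ‖m0‖^2) * (‖k0‖^2 - ‖m1‖^2) = 0 := by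
    have : ‖k0‖^2 * ‖k1‖^2 = ‖m0‖^2*‖m1‖^2 := by rw [← mul_pow, r0, mul_pow]
    linear_combination -this + ‖k0‖^2 * r1
  by_cases hm : ‖m0‖ = ‖k0‖
  · right
    refine ⟨k0⁻¹ * m0, ?_, ?_⟩
    · rw [norm_mul, norm_inv, hm]; field_simp
    · have hm0 : m0 ≠ 0 := by
        intro h0; rw [h0, norm_zero] at hm; exact hk'.ne hm
      have e : star k1 = k0⁻¹ * m0 * star m1 := by rw [mul_assoc, ← z0, ← mul_assoc, inv_mul_cancel₀ hk, one_mul]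
      have nv : ‖k0⁻¹ * m0‖ = 1 := by rw [norm_mul, norm_inv, hm]; field_simp
      have e2 : k1 = m1 * star (k0⁻¹ * m0) := by
        have := congrArg star e; rwa [star_star, star_mul, star_star] at this
      apply mul_left_cancel₀ hlin
      rw [hE, lin_mul_C, e2, mul_assoc m1, unit_star' nv, mul_one, ← mul_assoc, mul_inv_cancel₀ hk, one_mul]
  · left
    have hm1 : ‖m1‖ = ‖k0‖ := by
      rcases mul_eq_zero.1 r2 with h | h
      · exfalso; apply hm
        have := norm_nonneg m0
        nlinarith
      · have := norm_nonneg m1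
        nlinarith
    have hm0 : ‖m0‖ = ‖k1‖ := by
      have : ‖k0‖ * ‖k1‖ = ‖k0‖ * ‖m0‖ := by rw [r0, hm1, mul_comm]
      exact (mul_left_cancel₀ hk'.ne' this).symm
    have hlt : ‖k1‖ < ‖k0‖ := lt_of_le_of_ne hle (by rw [← hm0]; exact hm)
    rw [blaschke1_iff]
    refine ⟨-star (k0⁻¹ * k1), k0⁻¹ * m1, ?_, ?_, ?_⟩
    · rw [norm_neg, norm_star, norm_mul, norm_inv, inv_mul_lt_iff₀ hk']; simpa using hlt
    · rw [norm_mul, norm_inv, hm1]; field_simp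
    · have e1 : PowerSeries.C k0 * lin 1 (-(star (-star (k0⁻¹ * k1)))) = lin k0 k1 := by
        rw [← lin_zero_right, lin_mul_lin, star_neg, star_star, neg_neg, ← mul_assoc, mul_inv_cancel₀ hk]
        simp [quad_eq, lin_eq]
      have e2 : PowerSeries.C k0 * (lin (- -star (k0⁻¹ * k1)) 1 * PowerSeries.C (k0⁻¹ * m1)) = lin m0 m1 := by
        rw [lin_mul_C, ← lin_zero_right, lin_mul_lin, neg_neg, one_mul, ← mul_assoc k0 k0⁻¹, mul_inv_cancel₀ hk]
        have q : k0 * (star (k0⁻¹ * k1) * (k0⁻¹ * m1)) = m0 := by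
          have hs : star (k0⁻¹) * k0⁻¹ = ((‖k0‖^2 : ℝ) : H)⁻¹ := by
            rw [← nsq k0, mul_inv_rev, star_inv₀]
          calc k0 * (star (k0⁻¹ * k1) * (k0⁻¹ * m1)) = k0 * star k1 * (star (k0⁻¹) * k0⁻¹) * m1 := by
                rw [star_mul]; simp only [mul_assoc]
            _ = m0 * star m1 * ((‖k0‖^2 : ℝ) : H)⁻¹ * m1 := by rw [hs, z0]
            _ = m0 * (star m1 * m1) * ((‖k0‖^2 : ℝ) : H)⁻¹ := by
                rw [← Quaternion.coe_inv, mul_assoc, Quaternion.coe_commutes]; simp only [mul_assoc]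
            _ = m0 := by
                rw [nsq', hm1, mul_assoc, mul_inv_cancel₀, mul_one]
                have : (‖k0‖^2 : ℝ) ≠ 0 := by positivity
                intro h0; exact this (Quaternion.coe_injective (by rw [h0, Quaternion.coe_zero]))
        rw [q]
        simp [quad_eq, lin_eq]
      have hC : (PowerSeries.C k0 : PowerSeries H) ≠ 0 := by
        rw [← lin_zero_right]; exact lin_ne_zero (Or.inl hk)
      apply mul_left_cancel₀ hC
      rw [← mul_assoc, e1, e2, hE]

lemma sph (p : H) : p * p = (2 * p.re) • p - (‖p‖^2) • (1 : H) := by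
  have h : star p = ((2 * p.re : ℝ) : H) - p := by
    ext <;> simp; ring
  have := nsq' p
  rw [h, sub_mul, sub_eq_iff_eq_add, ← sub_eq_iff_eq_add'] at this
  rw [← this, Quaternion.coe_mul_eq_smul]
  congr 1
  rw [← Quaternion.coe_mul_eq_smul, mul_one]

lemma star_sph (p : H) : star p = (2 * p.re) • (1:H) - p := by
  rw [← Quaternion.coe_mul_eq_smul, mul_one]
  ext <;> simp; ring

lemma sph_conj {g : H} (p : H) (hg : g ≠ 0) : (g * p * g⁻¹) * (g * p * g⁻¹)
    = (2 * p.re) • (g * p * g⁻¹) - (‖p‖^2) • (1 : H) := by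
  have : (g * p * g⁻¹) * (g * p * g⁻¹) = g * (p * p) * g⁻¹ := by
    calc _ = g * p * (g⁻¹ * g) * p * g⁻¹ := by simp only [mul_assoc]
      _ = _ := by rw [inv_mul_cancel₀ hg]; simp only [mul_assoc, one_mul]
  rw [this, sph]
  simp [mul_sub, sub_mul, hg]

lemma norm_conj' {y x : H} (hy : y ≠ 0) : ‖y * x * y⁻¹‖ = ‖x‖ := by
  have : ‖y‖ ≠ 0 := by simpa using hy
  rw [norm_mul, norm_mul, norm_inv]; field_simp

lemma exists_s (d0 d1 d2 p : H) : ∃ s : H, ‖s‖ = ‖p‖ ∧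
    s * (d0 + s * d1 + s * s * d2) = (d0 + s * d1 + s * s * d2) * p := by
  set τ := 2 * p.re with hτ
  set ν := ‖p‖^2 with hν
  set A := d0 - ν • d2 with hA
  set B := d1 + τ • d2 with hB
  set g := A + B * star p with hg
  obtain ⟨s, hs, hss, hsg⟩ : ∃ s : H, ‖s‖ = ‖p‖ ∧ s * s = τ • s - ν • (1 : H) ∧ s * g = g * p := by
    by_cases h : g = 0
    · exact ⟨p, rfl, sph p, by simp [h]⟩
    · refine ⟨g * p * g⁻¹, norm_conj' h, sph_conj p h, ?_⟩
      rw [mul_assoc _ g⁻¹, inv_mul_cancel₀ h, mul_one]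
  refine ⟨s, hs, ?_⟩
  have e1 : d0 + s * d1 + s * s * d2 = A + s * B := by
    rw [hss, hA, hB]
    simp only [sub_mul, mul_add, smul_mul_assoc, one_mul, mul_smul_comm]
    abel
  rw [e1]
  have hp : star p * p = ν • (1:H) := by rw [nsq', ← Quaternion.coe_mul_eq_smul, mul_one]
  have h2 : s * (A + B * (τ • (1:H) - p)) = A * p + B * (ν • (1:H)) := by
    rw [← star_sph p, ← hp, ← mul_assoc, ← add_mul]; exact hsg
  rw [mul_add, ← mul_assoc, hss, add_mul]
  simp only [mul_sub, mul_add, mul_smul_comm, mul_one, sub_mul, smul_mul_assoc, one_mul] at h2 ⊢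
  have : A * p = s * A + (τ • (s * B) - s * (B * p)) - ν • B := by rw [h2]; abel
  rw [this, mul_assoc]; abel

/-- right-root gives left-root on the same sphere -/
lemma right_root {d0 d1 d2 z : H} (h : d0 + d1 * z + d2 * (z * z) = 0) :
    ∃ x : H, ‖x‖ = ‖z‖ ∧ d0 + x * d1 + x * x * d2 = 0 := by
  set τ := 2 * z.re with hτ
  set ν := ‖z‖^2 with hν
  have h1 : (d0 - ν • d2) + (d1 + τ • d2) * z = 0 := by
    rw [sph z] at h
    simp only [mul_sub, mul_smul_comm, mul_one, add_mul, smul_mul_assoc] at h ⊢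
    rw [← h]; abel
  set B := d1 + τ • d2 with hB
  have e1 : ∀ x : H, x * x = τ • x - ν • (1 : H) → d0 + x * d1 + x * x * d2 = (d0 - ν • d2) + x * B := by
    intro x hx
    rw [hx, hB]
    simp only [sub_mul, mul_add, smul_mul_assoc, one_mul, mul_smul_comm]
    abel
  by_cases hB0 : B = 0
  · refine ⟨z, rfl, ?_⟩
    rw [e1 z (sph z), ← h1, hB0]; simp
  · refine ⟨B * z * B⁻¹, norm_conj' hB0, ?_⟩
    rw [e1 _ (sph_conj z hB0), mul_assoc _ B⁻¹, inv_mul_cancel₀ hB0, mul_one, h1]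

/-- `D D^# = N N^#` -/
def C1 (d0 d1 d2 n0 n1 n2 : H) : Prop :=
  d0 * star d2 = n0 * star n2 ∧ d0 * star d1 + d1 * star d2 = n0 * star n1 + n1 * star n2 ∧
  d0 * star d0 + d1 * star d1 + d2 * star d2 = n0 * star n0 + n1 * star n1 + n2 * star n2

lemma C1_expand {d0 d1 d2 s : H} :
    (d0 + s * d1 + s * s * d2) * star d2 + s * (d0 + s * d1 + s * s * d2) * star d1 +
      s * s * (d0 + s * d1 + s * s * d2) * star d0 =
    d0 * star d2 + s * (d0 * star d1 + d1 * star d2) +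
    s * s * (d0 * star d0 + d1 * star d1 + d2 * star d2) +
    s * s * s * star (d0 * star d1 + d1 * star d2) + s * s * s * s * star (d0 * star d2) := by
  simp only [star_add, star_mul, star_star]
  noncomm_ring

lemma C1_root {d0 d1 d2 n0 n1 n2 s p : H} (h : C1 d0 d1 d2 n0 n1 n2)
    (hN : n0 + s * n1 + s * s * n2 = 0) (hD : d0 + s * d1 + s * s * d2 ≠ 0)
    (hs : s * (d0 + s * d1 + s * s * d2) = (d0 + s * d1 + s * s * d2) * p) :
    d2 + d1 * star p + d0 * (star p * star p) = 0 := by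
  have e : (d0 + s * d1 + s * s * d2) * (star d2 + p * star d1 + p * p * star d0) = 0 := by
    have h1 := @C1_expand d0 d1 d2 s
    have h2 := @C1_expand n0 n1 n2 s
    rw [h.1, h.2.1, h.2.2, ← h2, hN] at h1
    simp only [zero_mul, mul_zero, add_zero] at h1
    generalize d0 + s * d1 + s * s * d2 = y at hs h1 ⊢
    rw [← h1, mul_assoc s s, hs, ← mul_assoc s _ p, hs]
    simp only [mul_add, mul_assoc]
  have h3 := (mul_eq_zero.1 e).resolve_left hD
  have h4 := congrArg star h3
  simpa [star_add, star_mul] using h4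

lemma pw (d n d' n' w : H) : (d + n * star w) * star (d' + n' * star w) - (n + d * w) * star (n' + d' * w)
    = ((1 - ‖w‖^2 : ℝ) : H) * (d * star d' - n * star n') := by
  have h1 : n * star w * (w * star n') = ((‖w‖^2 : ℝ) : H) * (n * star n') := by
    rw [mul_assoc, ← mul_assoc (star w), nsq', ← mul_assoc, ← Quaternion.coe_commutes, mul_assoc]
  have h2 : d * w * (star w * star d') = ((‖w‖^2 : ℝ) : H) * (d * star d') := by
    rw [mul_assoc, ← mul_assoc w, nsq, ← mul_assoc, ← Quaternion.coe_commutes, mul_assoc]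
  simp only [star_add, star_mul, star_star, add_mul, mul_add, h1, h2]
  push_cast
  noncomm_ring

lemma C1_mobius {d0 d1 d2 n0 n1 n2 : H} (h : C1 d0 d1 d2 n0 n1 n2) (w : H) :
    C1 (d0 + n0 * star w) (d1 + n1 * star w) (d2 + n2 * star w) (n0 + d0 * w) (n1 + d1 * w) (n2 + d2 * w) := by
  obtain ⟨h1, h2, h3⟩ := h
  refine ⟨?_, ?_, ?_⟩
  · rw [← sub_eq_zero, pw, h1, sub_self, mul_zero]
  · rw [← sub_eq_zero, add_sub_add_comm, pw, pw, ← mul_add, ← add_sub_add_comm, h2, sub_self, mul_zero]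
  · rw [← sub_eq_zero, add_sub_add_comm, add_sub_add_comm, pw, pw, pw, ← mul_add, ← mul_add,
      ← add_sub_add_comm, ← add_sub_add_comm, h3, sub_self, mul_zero]

lemma re_comm (a b : H) : (a * b).re = (b * a).re := by simp; ring

lemma bd_expand (d0 d1 d2 x : H) (hx : ‖x‖ = 1) : ‖d0 + x * d1 + x * x * d2‖^2 =
    (d0 * star d0 + d1 * star d1 + d2 * star d2 +
      (2:ℝ) • ((d0 * star d1 + d1 * star d2) * star x) + (2:ℝ) • (d0 * star d2 * (star x * star x))).re := by
  have h0 : ((‖d0 + x * d1 + x * x * d2‖^2 : ℝ) : H).re = ‖d0 + x * d1 + x * x * d2‖^2 := Quaternion.re_coe _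
  rw [← h0, ← nsq]
  have xs := unit_star hx
  have sx := unit_star' hx
  have t1 : (x * d1 * (star d1 * star x)).re = (d1 * star d1).re := by
    rw [re_comm]
    congr 1
    calc star d1 * star x * (x * d1) = star d1 * (star x * x) * d1 := by simp only [mul_assoc]
      _ = d1 * star d1 := by rw [sx, mul_one, nsq, nsq']
  have t2 : (x * (x * d2) * (star d2 * (star x * star x))).re = (d2 * star d2).re := by
    rw [re_comm]
    congr 1
    calc star d2 * (star x * star x) * (x * (x * d2)) = star d2 * (star x * (star x * x) * x) * d2 := by simp only [mul_assoc]
      _ = d2 * star d2 := by rw [sx, mul_one, sx, mul_one, nsq, nsq']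
  have t3 : (x * d1 * star d0).re = (d0 * (star d1 * star x)).re := by
    rw [← Quaternion.re_star]; simp only [star_mul, star_star]
  have t4 : (x * (x * d2) * star d0).re = (d0 * (star d2 * (star x * star x))).re := by
    rw [← Quaternion.re_star]; simp only [star_mul, star_star, mul_assoc]
  have t5 : (x * d1 * (star d2 * (star x * star x))).re = (d1 * (star d2 * star x)).re := by
    rw [mul_assoc, re_comm]
    congr 1
    calc d1 * (star d2 * (star x * star x)) * x = d1 * (star d2 * star x) * (star x * x) := by simp only [mul_assoc]
      _ = _ := by rw [sx, mul_one]
  have t6 : (x * (x * d2) * (star d1 * star x)).re = (d1 * (star d2 * star x)).re := by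
    rw [← t5, ← Quaternion.re_star]; simp only [star_mul, star_star, mul_assoc]
  simp only [star_add, star_mul, star_star, mul_add, add_mul, Quaternion.re_add, Quaternion.re_smul, smul_add, mul_assoc] at *
  rw [t1, t2, t3, t4, t5, t6]
  simp only [smul_eq_mul]
  ring

lemma C1_boundary {d0 d1 d2 n0 n1 n2 x : H} (h : C1 d0 d1 d2 n0 n1 n2) (hx : ‖x‖ = 1) :
    ‖d0 + x * d1 + x * x * d2‖ = ‖n0 + x * n1 + x * x * n2‖ := by
  have := bd_expand d0 d1 d2 x hx
  rw [h.1, h.2.1, h.2.2, ← bd_expand n0 n1 n2 x hx] at this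
  exact (sq_eq_sq₀ (norm_nonneg _) (norm_nonneg _)).1 this

lemma C1_cancel {s k0 k1 m0 m1 : H}
    (h : C1 (-(s * k0)) (k0 - s * k1) k1 (-(s * m0)) (m0 - s * m1) m1) :
    k0 * star k1 = m0 * star m1 ∧ k0 * star k0 + k1 * star k1 = m0 * star m0 + m1 * star m1 := by
  obtain ⟨h1, h2, h3⟩ := h
  by_cases hs : s = 0
  · subst hs
    simp at h2 h3
    exact ⟨h2, h3⟩
  · have z0 : k0 * star k1 = m0 * star m1 := by
      apply mul_left_cancel₀ hs
      simpa [mul_assoc] using h1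
    refine ⟨z0, ?_⟩
    apply mul_left_cancel₀ hs
    have e : ∀ k0 k1 : H, s * (k0 * star k0 + k1 * star k1) =
      s * (k0 * star k1) * star s + k0 * star k1 - (-(s * k0) * star (k0 - s * k1) + (k0 - s * k1) * star k1) := by
      intro k0 k1
      simp only [star_sub, star_mul]
      noncomm_ring
    rw [e, e, h2, z0]

structure Rep2 (a : ℕ → H) (d0 d1 d2 n0 n1 n2 : H) : Prop where
  eq : quad d0 d1 d2 * PowerSeries.mk a = quad n0 n1 n2
  c1 : C1 d0 d1 d2 n0 n1 n2
  nz : ∀ x : H, ‖x‖ ≤ 1 → d0 + x * d1 + x * x * d2 ≠ 0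

lemma C1_T {e0 e1 p n0 n1 n2 : H} (h : C1 e0 (e1 - e0 * star p) (-(e1 * star p)) n0 n1 n2) :
    C1 (-(e0 * p)) (e0 - e1 * p) e1 n0 n1 n2 := by
  obtain ⟨h1, h2, h3⟩ := h
  have hpp : star p * p = p * star p := by rw [nsq, nsq']
  have hpp2 : ∀ x, star p * (p * x) = p * (star p * x) := by
    intro x; rw [← mul_assoc, hpp, mul_assoc]
  refine ⟨?_, ?_, ?_⟩
  · rw [← h1]; simp [mul_assoc]
  · rw [← h2]
    simp only [star_sub, star_neg, star_mul, star_star, mul_sub, sub_mul, mul_assoc, neg_mul, mul_neg, hpp2]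
    abel
  · rw [← h3]
    simp only [star_sub, star_neg, star_mul, star_star, mul_sub, sub_mul, mul_assoc, neg_mul, mul_neg, hpp2]
    abel

lemma mk_swap (A : PowerSeries H) (w : H) :
    (A - PowerSeries.C w) * (1 - PowerSeries.C (star w) * A) =
    (1 - A * PowerSeries.C (star w)) * (A - PowerSeries.C w) := by
  have h : PowerSeries.C w * (PowerSeries.C (star w) * A) = A * (PowerSeries.C (star w) * PowerSeries.C w) := by
    rw [← mul_assoc, ← map_mul, ← map_mul, nsq, nsq']
    ext1 n
    simp only [PowerSeries.coeff_C_mul, PowerSeries.coeff_mul_C]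
    exact Quaternion.coe_commutes _ _
  simp only [mul_sub, sub_mul, one_mul, mul_one, h, mul_assoc]
  abel

lemma one_sub_ps_ne {a : ℕ → H} (ha : SelfMap a) {w : H} (hw : ‖w‖ < 1) :
    (1 - PowerSeries.C (star w) * PowerSeries.mk a) ≠ 0 := by
  intro h
  have h1 := congrArg (PowerSeries.coeff 0) h
  simp at h1
  exact one_sub_ne (x := star w) (y := a 0) (by rwa [norm_star]) (norm_a0 ha).le h1

lemma keyK {a : ℕ → H} (ha : SelfMap a) {d0 d1 d2 n0 n1 n2 : H} (r : Rep2 a d0 d1 d2 n0 n1 n2)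
    {p : H} (hp : ‖p‖ < 1) : ∃ k0 k1 m0 m1 : H, lin k0 k1 * PowerSeries.mk (hdqC a p) = lin m0 m1 ∧
      k0 * star k1 = m0 * star m1 ∧ k0 * star k0 + k1 * star k1 = m0 * star m0 + m1 * star m1 ∧
      k0 ≠ 0 ∧ ‖k1‖ ≤ ‖k0‖ := by
  obtain ⟨s, hs, hsy⟩ := exists_s d0 d1 d2 p
  have hsl : ‖s‖ < 1 := by rw [hs]; exact hp
  have hy := r.nz s hsl.le
  have hNs := eval_quad ha.1 r.eq hsl hy
  set y := d0 + s * d1 + s * s * d2 with hydef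
  rw [mul_assoc y⁻¹, hsy, ← mul_assoc, inv_mul_cancel₀ hy, one_mul] at hNs
  have hh := hdq_eq ha hp
  have hw := ha.2 p hp
  set w := evalC a p with hwdef
  have hC := C1_mobius r.c1 (-w)
  -- interior nonvanishing
  have hint : ∀ x : H, ‖x‖ < 1 → (d0 + n0 * star (-w)) + x * (d1 + n1 * star (-w)) + x * x * (d2 + n2 * star (-w)) ≠ 0 := by
    intro x hx
    have hy := r.nz x hx.le
    have e := eval_quad ha.1 r.eq hx hy
    have hx' : ‖(d0 + x * d1 + x * x * d2)⁻¹ * x * (d0 + x * d1 + x * x * d2)‖ < 1 := by rwa [norm_conj hy]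
    set Y := d0 + x * d1 + x * x * d2 with hY
    have : (d0 + n0 * star (-w)) + x * (d1 + n1 * star (-w)) + x * x * (d2 + n2 * star (-w))
        = Y - (n0 + x * n1 + x * x * n2) * star w := by
      rw [hY, star_neg]; noncomm_ring
    rw [this, e, mul_assoc]
    have h2 := one_sub_ne (ha.2 _ hx') (y := star w) (by rw [norm_star]; exact hw.le)
    have := mul_ne_zero hy h2
    rwa [mul_sub, mul_one] at this
  have hps1 : quad (d0 + n0 * star (-w)) (d1 + n1 * star (-w)) (d2 + n2 * star (-w)) =
      quad d0 d1 d2 * (1 - PowerSeries.mk a * PowerSeries.C (star w)) := by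
    rw [mul_sub, ← mul_assoc, r.eq, mul_one, ← quad_add, ← quad_mul_C, star_neg, map_neg, mul_neg, sub_eq_add_neg]
  have hps2 : quad (n0 + d0 * (-w)) (n1 + d1 * (-w)) (n2 + d2 * (-w)) =
      quad d0 d1 d2 * (PowerSeries.mk a - PowerSeries.C w) := by
    rw [mul_sub, r.eq, ← quad_add, ← quad_mul_C, map_neg, mul_neg, sub_eq_add_neg]
  have hDs : (d0 + n0 * star (-w)) + s * (d1 + n1 * star (-w)) + s * s * (d2 + n2 * star (-w))
      = ((1 - ‖w‖^2 : ℝ) : H) * y := by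
    have : (d0 + n0 * star (-w)) + s * (d1 + n1 * star (-w)) + s * s * (d2 + n2 * star (-w))
        = y - (n0 + s * n1 + s * s * n2) * star w := by
      rw [hydef, star_neg]; noncomm_ring
    rw [this, hNs, mul_assoc, nsq, ← Quaternion.coe_commutes]
    push_cast
    noncomm_ring
  have hN0 : (n0 + d0 * (-w)) + s * (n1 + d1 * (-w)) + s * s * (n2 + d2 * (-w)) = 0 := by
    have : (n0 + d0 * (-w)) + s * (n1 + d1 * (-w)) + s * s * (n2 + d2 * (-w)) =
      (n0 + s * n1 + s * s * n2) - y * w := by rw [hydef]; noncomm_ring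
    rw [this, hNs, sub_self]
  have hsD : s * ((d0 + n0 * star (-w)) + s * (d1 + n1 * star (-w)) + s * s * (d2 + n2 * star (-w)))
     = ((d0 + n0 * star (-w)) + s * (d1 + n1 * star (-w)) + s * s * (d2 + n2 * star (-w))) * p := by
    rw [hDs, ← mul_assoc, ← Quaternion.coe_commutes, mul_assoc, hsy, mul_assoc]
  have hDne := hint s hsl
  clear hDs hydef
  generalize d0 + n0 * star (-w) = d0' at *
  generalize d1 + n1 * star (-w) = d1' at *
  generalize d2 + n2 * star (-w) = d2' at *
  generalize n0 + d0 * (-w) = n0' at *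
  generalize n1 + d1 * (-w) = n1' at *
  generalize n2 + d2 * (-w) = n2' at *
  have hroot := C1_root hC hN0 hDne hsD
  obtain ⟨e1, he1⟩ : ∃ e1, e1 = d1' + d0' * star p := ⟨_, rfl⟩
  have hd1 : d1' = e1 - d0' * star p := by rw [he1]; abel
  have hd2 : d2' = -(e1 * star p) := by
    rw [he1, eq_neg_iff_add_eq_zero, ← hroot]; noncomm_ring
  obtain ⟨m0, hm0⟩ : ∃ m0, m0 = n1' + s * n2' := ⟨_, rfl⟩
  have hn1 : n1' = m0 - s * n2' := by rw [hm0]; abel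
  have hn0 : n0' = -(s * m0) := by
    rw [hm0, eq_neg_iff_add_eq_zero, ← hN0]; noncomm_ring
  subst hd1 hd2 hn1 hn0
  clear hroot
  have hY : s * (d0' + s * e1) - (d0' + s * e1) * p = 0 := by
    set Y := s * (d0' + s * e1) - (d0' + s * e1) * p with hYd
    have hpp : p * star p = star p * p := by rw [nsq, nsq']
    have h1 : Y = s * Y * star p := by
      rw [← sub_eq_zero]
      have : Y - s * Y * star p = s * (d0' + s * (e1 - d0' * star p) + s * s * -(e1 * star p)) -
         (d0' + s * (e1 - d0' * star p) + s * s * -(e1 * star p)) * p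
         + s * (d0' + s * e1) * (p * star p - star p * p) := by
        rw [hYd]; noncomm_ring
      rw [this, hsD, hpp, sub_self, sub_self, mul_zero, add_zero]
    have h2 := congrArg norm h1
    rw [norm_mul, norm_mul, norm_star, hs] at h2
    by_contra h3
    have h4 : 0 < ‖Y‖ := by simpa using h3
    have h5 : ‖p‖ * ‖p‖ < 1 := by nlinarith [norm_nonneg p]
    nlinarith
  obtain ⟨k0, hk0⟩ : ∃ k0, k0 = d0' - e1 * p + s * e1 := ⟨_, rfl⟩
  have hsk : s * k0 = d0' * p := by
    rw [hk0, ← sub_eq_zero, ← hY]; noncomm_ring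
  have hk01 : k0 - s * e1 = d0' - e1 * p := by rw [hk0]; abel
  have hz := C1_cancel (s := s) (k0 := k0) (k1 := e1) (m0 := m0) (m1 := n2') (by
    rw [hsk, hk01]; exact C1_T hC)
  have hd0ne : d0' ≠ 0 := by
    have := hint 0 (by simp)
    simpa using this
  have hnk : ‖k0‖ = ‖d0'‖ := by
    by_cases hp0 : p = 0
    · have : s = 0 := by rw [← norm_eq_zero, hs, hp0, norm_zero]
      rw [hk0, hp0, this]; simp
    · have h1 := congrArg norm hsk
      rw [norm_mul, norm_mul, hs, mul_comm] at h1
      exact mul_right_cancel₀ (by simpa using hp0) h1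
  refine ⟨k0, e1, m0, n2', ?_, hz.1, hz.2, ?_, ?_⟩
  · have hA : lin d0' e1 * lin (-p) 1 = lin (-s) 1 * lin k0 e1 := by
      rw [lin_mul_lin, lin_mul_lin]
      congr 1
      · rw [neg_mul, hsk, mul_neg]
      · rw [mul_one, one_mul, mul_neg, neg_mul, ← sub_eq_add_neg, ← hk01]; abel
      · simp
    have hB : lin d0' e1 * lin 1 (-(star p)) = quad d0' (e1 - d0' * star p) (-(e1 * star p)) := by
      rw [lin_mul_lin]; congr 1
      · simp
      · rw [mul_one, mul_neg]; abel
      · simp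
    have hD : lin (-s) 1 * lin m0 n2' = quad (-(s * m0)) (m0 - s * n2') n2' := by
      rw [lin_mul_lin]; congr 1
      · simp
      · rw [one_mul, neg_mul]; abel
      · simp
    apply mul_left_cancel₀ (lin_ne_zero (a := -s) (b := 1) (by simp))
    apply mul_right_cancel₀ (one_sub_ps_ne ha hw)
    rw [hD, hps2, mul_assoc (quad d0 d1 d2), mk_swap, ← mul_assoc (quad d0 d1 d2), ← hps1, ← hB,
      mul_assoc (lin d0' e1), ← hh]
    simp only [← mul_assoc]
    rw [hA]
  · rw [← norm_pos_iff, hnk]; simpa using hd0ne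
  · rw [hnk]
    by_contra hlt
    push Not at hlt
    have he : e1 ≠ 0 := by
      intro h; rw [h, norm_zero] at hlt; linarith [norm_nonneg d0']
    apply hint (-(d0' * e1⁻¹))
    · rw [norm_neg, norm_mul, norm_inv, ← div_eq_mul_inv, div_lt_one (by simpa using he)]; exact hlt
    · have h0 : d0' + -(d0' * e1⁻¹) * e1 = 0 := by
        rw [neg_mul, mul_assoc, inv_mul_cancel₀ he]; simp
      generalize -(d0' * e1⁻¹) = x at h0 ⊢
      have : d0' + x * (e1 - d0' * star p) + x * x * -(e1 * star p) =
        (d0' + x * e1) - x * (d0' + x * e1) * star p := by noncomm_ring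
      rw [this, h0]; simp

lemma o_re : QuaternionAlgebra.re (1:H) = 1 := rfl
lemma o_i : QuaternionAlgebra.imI (1:H) = 0 := rfl
lemma o_j : QuaternionAlgebra.imJ (1:H) = 0 := rfl
lemma o_k : QuaternionAlgebra.imK (1:H) = 0 := rfl

lemma norm_one_sub_swap (p t : H) : ‖1 - star t * p‖ = ‖1 - p * star t‖ := by
  have h : ‖1 - star t * p‖^2 = ‖1 - p * star t‖^2 := by
    rw [sq, sq, ← Quaternion.normSq_eq_norm_mul_self, ← Quaternion.normSq_eq_norm_mul_self,
      Quaternion.normSq_def', Quaternion.normSq_def']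
    simp [o_re, o_i, o_j, o_k]
    ring
  exact (sq_eq_sq₀ (norm_nonneg _) (norm_nonneg _)).1 h

lemma C1_base {c p t u : H} (hc : c - c * p * star t = 1 - star t * p) (hcn : ‖c‖ = 1) (hu : ‖u‖ = 1) :
    C1 c (-(c * star p) - star t) (star t * star p) (c * p * t * u) ((-(c * p) - t) * u) u := by
  have hcs : star c - t * star p * star c = 1 - star p * t := by
    have := congrArg star hc
    simpa [star_sub, star_mul, mul_assoc] using this
  have hpp : star p * p = p * star p := by rw [nsq, nsq']
  have htt : star t * t = t * star t := by rw [nsq, nsq']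
  have huu : ∀ x y : H, (x * u) * star (y * u) = x * star y := by
    intro x y
    rw [star_mul, mul_assoc, ← mul_assoc u, unit_star hu, one_mul]
  have huu1 : ∀ x : H, (x * u) * star u = x := by
    intro x
    rw [mul_assoc, unit_star hu, mul_one]
  have hcc := unit_star hcn
  refine ⟨?_, ?_, ?_⟩
  · rw [huu1]; simp [mul_assoc]
  · rw [huu, huu1]
    have e : c * star (-(c * star p) - star t) + (-(c * star p) - star t) * star (star t * star p)
       - (c * p * t * star (-(c * p) - t) + (-(c * p) - t))
       = -(c * p * ((star c - t * star p * star c) - (1 - star p * t)))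
         - ((c - c * p * star t) - (1 - star t * p)) * t
         - c * (star p * p - p * star p) * t - c * p * (star t * t - t * star t) := by
      simp only [star_sub, star_neg, star_mul, star_star]
      noncomm_ring
    rw [← sub_eq_zero, e, hc, hcs, hpp, htt]
    simp
  · rw [huu, huu, unit_star hu, hcc]
    have hr : ∃ r : ℝ, p * star t + t * star p = (r : H) ∧ star t * p + star p * t = (r : H) := by
      refine ⟨(p * star t + t * star p).re, ?_, ?_⟩
      · ext <;> simp <;> ring
      · ext <;> simp <;> ring
    obtain ⟨r, hr1, hr2⟩ := hr
    have q1 : star t * p * star c = star c - 1 + c * (p * star t) * star c := by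
      have : star t * p = 1 - (c - c * p * star t) := by rw [hc]; abel
      rw [this, sub_mul, sub_mul, hcc, one_mul, mul_assoc c p]; abel
    have q2 : c * star p * t = c - 1 + c * (t * star p) * star c := by
      have := congrArg star q1
      simpa [star_sub, star_mul, mul_assoc] using this
    have q3 : c * p * star t = c - 1 + star t * p := by
      calc c * p * star t = c - (c - c * p * star t) := by abel
        _ = c - (1 - star t * p) := by rw [hc]
        _ = _ := by abel
    have q4 : t * star p * star c = star c - 1 + star p * t := by
      have := congrArg star q3
      simpa [star_sub, star_mul, mul_assoc] using this
    have q5 : c * (p * star t) * star c + c * (t * star p) * star c = star t * p + star p * t := by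
      rw [← add_mul, ← mul_add, hr1, hr2, ← Quaternion.coe_commutes, mul_assoc, hcc, mul_one]
    have w1 : c * star p * (p * star c) = star p * p := by
      rw [mul_assoc, ← mul_assoc (star p), nsq', ← mul_assoc, ← Quaternion.coe_commutes, mul_assoc, hcc, mul_one]
    have w2 : c * p * (star p * star c) = star p * p := by
      rw [mul_assoc, ← mul_assoc p, nsq, nsq', ← mul_assoc, ← Quaternion.coe_commutes, mul_assoc, hcc, mul_one]
    have w3 : c * p * t * star (c * p * t) = star t * star p * star (star t * star p) := by
      rw [nsq, nsq]; congr 1; simp [norm_mul, hcn, mul_comm]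
    have e1 : (-(c * star p) - star t) * star (-(c * star p) - star t) =
      star p * p + star t * t + (c * star p * t + star t * p * star c) := by
      rw [← w1]; simp only [star_sub, star_neg, star_mul, star_star]; noncomm_ring
    have e2 : (-(c * p) - t) * star (-(c * p) - t) =
      star p * p + star t * t + (c * p * star t + t * star p * star c) := by
      rw [← w2, htt]; simp only [star_sub, star_neg, star_mul, star_star]; noncomm_ring
    have e3 : c * star p * t + star t * p * star c = c * p * star t + t * star p * star c := by
      rw [q1, q2, q3, q4]
      have : c - 1 + star t * p + (star c - 1 + star p * t) = c - 1 + (star c - 1) + (star t * p + star p * t) := by abel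
      rw [this, ← q5]; abel
    rw [e1, e2, e3, w3]; abel

lemma rep_exists {a : ℕ → H} (ha : SelfMap a) {p t u w : H} (hp : ‖p‖ < 1) (ht : ‖t‖ < 1) (hu : ‖u‖ = 1)
    (hw : ‖w‖ < 1) {g : PowerSeries H} (hg : lin 1 (-(star t)) * g = lin (-t) 1 * PowerSeries.C u)
    (h : lin (-p) 1 * g * (1 - PowerSeries.C (star w) * PowerSeries.mk a) =
      lin 1 (-(star p)) * (PowerSeries.mk a - PowerSeries.C w)) :
    ∃ d0 d1 d2 n0 n1 n2 : H, Rep2 a d0 d1 d2 n0 n1 n2 := by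
  have hne : 1 - p * star t ≠ 0 := one_sub_ne hp (by rw [norm_star]; exact ht.le)
  obtain ⟨c, hcd⟩ : ∃ c, c = (1 - star t * p) * (1 - p * star t)⁻¹ := ⟨_, rfl⟩
  have hc : c - c * p * star t = 1 - star t * p := by
    have : c - c * p * star t = c * (1 - p * star t) := by noncomm_ring
    rw [this, hcd, mul_assoc, inv_mul_cancel₀ hne, mul_one]
  have hcn : ‖c‖ = 1 := by
    rw [hcd, norm_mul, norm_inv, norm_one_sub_swap]
    exact mul_inv_cancel₀ (by simpa using hne)
  have hC := C1_base hc hcn hu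
  have hC' := C1_mobius hC w
  have hDF : lin c (-(star t)) * lin 1 (-(star p)) = quad c (-(c * star p) - star t) (star t * star p) := by
    rw [lin_mul_lin]; congr 1
    · simp
    · rw [mul_one, mul_neg]; abel
    · simp
  have hNF : lin (-(c * p)) 1 * lin (-t) 1 * PowerSeries.C u = quad (c * p * t * u) ((-(c * p) - t) * u) u := by
    rw [lin_mul_lin, quad_mul_C]; congr 1
    · simp
    · rw [mul_one, one_mul]; rfl
    · simp
  have hsw : lin c (-(star t)) * lin (-p) 1 = lin (-(c * p)) 1 * lin 1 (-(star t)) := by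
    rw [lin_mul_lin, lin_mul_lin]; congr 1
    · simp
    · rw [mul_one, mul_one, neg_mul_neg, neg_mul_neg, ← sub_eq_zero, ← sub_eq_zero.2 hc]; abel
    · simp
  have hmain : quad c (-(c * star p) - star t) (star t * star p) * (PowerSeries.mk a - PowerSeries.C w)
      = quad (c * p * t * u) ((-(c * p) - t) * u) u * (1 - PowerSeries.C (star w) * PowerSeries.mk a) := by
    rw [← hDF, mul_assoc, ← h, ← hNF, mul_assoc (lin (-(c * p)) 1), ← hg]
    simp only [← mul_assoc]
    rw [hsw]
  have hnzF : ∀ x : H, ‖x‖ ≤ 1 → c + x * (-(c * star p) - star t) + x * x * (star t * star p) ≠ 0 := by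
    intro x hx h0
    have e : c + x * (-(c * star p) - star t) + x * x * (star t * star p) =
      (c - x * star t) - x * (c - x * star t) * star p := by noncomm_ring
    rw [e] at h0
    have hy : c - x * star t ≠ 0 := by
      intro h1
      have := congrArg norm (sub_eq_zero.1 h1)
      rw [hcn, norm_mul, norm_star] at this
      nlinarith [norm_nonneg x, norm_nonneg t]
    have h2 := congrArg norm (sub_eq_zero.1 h0)
    rw [norm_mul, norm_mul, norm_star] at h2
    have h3 : 0 < ‖c - x * star t‖ := by simpa using hy
    have h4 : ‖x‖ * ‖p‖ < 1 := by nlinarith [norm_nonneg x, norm_nonneg p]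
    nlinarith
  generalize -(c * star p) - star t = d1 at *
  generalize star t * star p = d2 at *
  generalize c * p * t * u = n0 at *
  generalize (-(c * p) - t) * u = n1 at *
  have heq : quad (c + n0 * star w) (d1 + n1 * star w) (d2 + u * star w) * PowerSeries.mk a =
      quad (n0 + c * w) (n1 + d1 * w) (u + d2 * w) := by
    rw [← quad_add, ← quad_add, ← quad_mul_C, ← quad_mul_C, add_mul]
    rw [mul_sub, mul_sub, mul_one, sub_eq_iff_eq_add] at hmain
    rw [hmain, ← mul_assoc]; abel
  refine ⟨_, _, _, _, _, _, heq, hC', ?_⟩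
  intro x hx h0
  have e1 : (c + n0 * star w) + x * (d1 + n1 * star w) + x * x * (d2 + u * star w) =
    (c + x * d1 + x * x * d2) + (n0 + x * n1 + x * x * u) * star w := by noncomm_ring
  have e2 : (n0 + c * w) + x * (n1 + d1 * w) + x * x * (u + d2 * w) =
    (n0 + x * n1 + x * x * u) + (c + x * d1 + x * x * d2) * w := by noncomm_ring
  have hF := hnzF x hx
  rcases hx.lt_or_eq with hlt | heq1
  · have h1 := eval_quad_zero ha.1 heq hlt h0
    rw [e1] at h0
    rw [e2] at h1
    apply one_sub_ne hw (y := star w) (by rw [norm_star]; exact hw.le)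
    apply (mul_eq_zero.1 _).resolve_left hF
    generalize c + x * d1 + x * x * d2 = D at *
    generalize n0 + x * n1 + x * x * u = N at *
    have : D * (1 - w * star w) = (D + N * star w) - (N + D * w) * star w := by noncomm_ring
    rw [this, h0, h1]; simp
  · have hb := C1_boundary hC heq1
    rw [e1] at h0
    have h2 := congrArg norm (eq_neg_of_add_eq_zero_left h0)
    rw [norm_neg, norm_mul, norm_star, ← hb] at h2
    have h3 : 0 < ‖c + x * d1 + x * x * d2‖ := by simpa using hF
    nlinarith

lemma const_case {a : ℕ → H} (ha : SelfMap a) {p v : H} (hp : ‖p‖ < 1) (hv : ‖v‖ = 1)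
    (h : PowerSeries.mk (hdqC a p) = PowerSeries.C v) : IsBlaschke a 1 := by
  have hh := hdq_eq ha hp
  have hw := ha.2 p hp
  set w := evalC a p
  rw [h] at hh
  have hE : lin (1 + -(p * v) * star w) (-(star p) + v * star w) * PowerSeries.mk a =
      lin (-(p * v) + 1 * w) (v + -(star p) * w) := by
    have l1 : lin (1 + -(p * v) * star w) (-(star p) + v * star w) =
      lin 1 (-(star p)) + lin (-p) 1 * PowerSeries.C v * PowerSeries.C (star w) := by
      rw [lin_mul_C, lin_mul_C]; simp only [lin_eq, map_add, mul_add, one_mul, neg_mul]; abel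
    have l2 : lin (-(p * v) + 1 * w) (v + -(star p) * w) =
      lin (-p) 1 * PowerSeries.C v + lin 1 (-(star p)) * PowerSeries.C w := by
      rw [lin_mul_C, lin_mul_C]; simp only [lin_eq, map_add, mul_add, one_mul, neg_mul]; abel
    rw [l1, l2, add_mul]
    rw [mul_sub, mul_sub, mul_one, eq_sub_iff_add_eq] at hh
    rw [← hh]; simp only [mul_assoc]; abel
  have hvv := unit_star hv
  have z0 := pw 1 (-(p * v)) (-(star p)) v w
  have z1 := pw 1 (-(p * v)) 1 (-(p * v)) w
  have z2 := pw (-(star p)) v (-(star p)) v w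
  have f0 : 1 * star (-(star p)) - -(p * v) * star v = 0 := by
    rw [neg_mul, mul_assoc, hvv]; simp
  have f1 : (1 * star (1:H) - -(p * v) * star (-(p * v))) + (-(star p) * star (-(star p)) - v * star v) = 0 := by
    rw [hvv, nsq (-(p*v)), nsq (-(star p)), norm_neg, norm_neg, norm_mul, hv, norm_star]; simp
  rw [f0, mul_zero, sub_eq_zero] at z0
  have z3 := congrArg₂ (· + ·) z1 z2
  simp only [← mul_add, f1, mul_zero] at z3
  rw [← add_sub_add_comm, sub_eq_zero] at z3
  have hk : 1 + -(p * v) * star w ≠ 0 := by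
    have := one_sub_ne hp (y := v * star w) (by rw [norm_mul, hv, norm_star, one_mul]; exact hw.le)
    rwa [← mul_assoc, sub_eq_add_neg, ← neg_mul] at this
  have hle : ‖-(star p) + v * star w‖ ≤ ‖1 + -(p * v) * star w‖ := by
    have hb : ‖v * star w‖ < 1 := by rw [norm_mul, hv, norm_star, one_mul]; exact hw
    rw [neg_mul, mul_assoc]
    generalize v * star w = b at hb
    have : ‖-(star p) + b‖^2 = ‖1 + -(p * b)‖^2 - (1 - ‖p‖^2) * (1 - ‖b‖^2) := by
      simp only [sq, ← Quaternion.normSq_eq_norm_mul_self, Quaternion.normSq_def']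
      simp [o_re, o_i, o_j, o_k]
      ring
    have h1 : 0 ≤ (1 - ‖p‖^2) * (1 - ‖b‖^2) := by
      apply mul_nonneg <;> nlinarith [norm_nonneg p, norm_nonneg b]
    exact (sq_le_sq₀ (norm_nonneg _) (norm_nonneg _)).1 (by linarith)
  rcases deg1 hE z0 z3 hk hle with h1 | ⟨v', hv', h1⟩
  · exact h1
  · exfalso
    have := congrArg (PowerSeries.coeff 0) h1
    simp at this
    have h2 := norm_a0 ha
    rw [this, hv'] at h2
    exact lt_irrefl _ h2

lemma quartic_root (c0 c1 c2 c3 c4 : ℝ) (h : c4 ≠ 0) :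
    ∃ z : ℂ, (c0 : ℂ) + c1 * z + c2 * z^2 + c3 * z^3 + c4 * z^4 = 0 := by
  obtain ⟨z, hz⟩ := Complex.exists_root (f := (Polynomial.C (c0:ℂ) + Polynomial.C (c1:ℂ) * Polynomial.X +
      Polynomial.C (c2:ℂ) * Polynomial.X^2 + Polynomial.C (c3:ℂ) * Polynomial.X^3 +
      Polynomial.C (c4:ℂ) * Polynomial.X^4)) (by
    have h4 : (c4 : ℂ) ≠ 0 := by exact_mod_cast h
    have : (Polynomial.C (c0:ℂ) + Polynomial.C (c1:ℂ) * Polynomial.X +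
      Polynomial.C (c2:ℂ) * Polynomial.X^2 + Polynomial.C (c3:ℂ) * Polynomial.X^3 +
      Polynomial.C (c4:ℂ) * Polynomial.X^4).degree = 4 := by compute_degree!
    rw [this]; norm_num)
  refine ⟨z, ?_⟩
  simpa [Polynomial.IsRoot] using hz

lemma quartic_re_im (n0 n1 n2 : H) (h : n2 ≠ 0) : ∃ x y : ℝ,
    (2 * ((n0 - (x^2+y^2) • n2) * star (n1 + (2*x) • n2)).re + ‖n1 + (2*x) • n2‖^2 * (2*x)) * y = 0 ∧
    ‖n0 - (x^2+y^2) • n2‖^2 - ‖n1 + (2*x) • n2‖^2 * (x^2+y^2) +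
    (2 * ((n0 - (x^2+y^2) • n2) * star (n1 + (2*x) • n2)).re + ‖n1 + (2*x) • n2‖^2 * (2*x)) * x = 0 := by
  obtain ⟨z, hz⟩ := quartic_root (‖n0‖^2) (2 * (n0 * star n1).re) (‖n1‖^2 + 2 * (n0 * star n2).re)
    (2 * (n1 * star n2).re) (‖n2‖^2) (by simpa using h)
  obtain ⟨x, y⟩ := z
  have h1 := congrArg Complex.re hz
  have h2 := congrArg Complex.im hz
  refine ⟨x, y, ?_, ?_⟩
  · simp only [sq, ← Quaternion.normSq_eq_norm_mul_self, Quaternion.normSq_def'] at h2 ⊢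
    simp [pow_succ, -mul_eq_zero] at h2 ⊢
    linear_combination h2
  · simp only [sq, ← Quaternion.normSq_eq_norm_mul_self, Quaternion.normSq_def'] at h1 ⊢
    simp [pow_succ, -mul_eq_zero] at h1 ⊢
    linear_combination h1

lemma fta {n0 n1 n2 : H} (h : n1 ≠ 0 ∨ n2 ≠ 0) : ∃ s : H, n0 + s * n1 + s * s * n2 = 0 := by
  by_cases h2 : n2 = 0
  · have h1 : n1 ≠ 0 := h.resolve_right (by simpa using h2)
    exact ⟨-n0 * n1⁻¹, by rw [h2, mul_assoc, inv_mul_cancel₀ h1]; simp⟩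
  obtain ⟨x, y, e1, e2⟩ := quartic_re_im n0 n1 n2 h2
  have key : ∀ s : H, s * s = (2*x) • s - (x^2+y^2) • (1:H) →
      n0 + s * n1 + s * s * n2 = (n0 - (x^2+y^2) • n2) + s * (n1 + (2*x) • n2) := by
    intro s hs
    rw [hs, sub_mul, smul_mul_assoc, smul_mul_assoc, one_mul, mul_add, mul_smul_comm]; abel
  generalize n0 - (x^2+y^2) • n2 = A at *
  generalize n1 + (2*x) • n2 = B at *
  by_cases hB : B = 0
  · subst hB
    have z0 : QuaternionAlgebra.re (0:H) = 0 := rfl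
    have hA : A = 0 := by simpa [z0] using e2
    obtain ⟨s, e1, e2, e3, e4⟩ : ∃ s : H, s.re = x ∧ s.imI = y ∧ s.imJ = 0 ∧ s.imK = 0 := ⟨⟨x, y, 0, 0⟩, rfl, rfl, rfl, rfl⟩
    refine ⟨s, ?_⟩
    rw [key, hA]
    · simp
    · ext <;> simp [o_re, o_i, o_j, o_k, e1, e2, e3, e4] <;> ring
  by_cases hy : y = 0
  · subst hy
    refine ⟨(x : H), ?_⟩
    rw [key]
    · have : ‖A + (x:H) * B‖^2 = 0 := by
        rw [← e2]
        simp only [sq, ← Quaternion.normSq_eq_norm_mul_self, Quaternion.normSq_def']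
        simp
        ring
      simpa using this
    · ext <;> simp [o_re, o_i, o_j, o_k] <;> ring
  · have e3 := (mul_eq_zero.1 e1).resolve_right hy
    rw [e3] at e2
    have hBn : ‖B‖ ≠ 0 := by simpa using hB
    obtain ⟨s, hs⟩ : ∃ s, s = -A * B⁻¹ := ⟨_, rfl⟩
    have hsB : A = -(s * B) := by rw [hs, mul_assoc, inv_mul_cancel₀ hB]; simp
    have f1 : s.re = x := by
      have : (A * star B).re = - (‖B‖^2 * s.re) := by
        rw [hsB, neg_mul, mul_assoc, nsq]; generalize ‖B‖^2 = r; simp; ring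
      rw [this] at e3
      have : ‖B‖^2 * (x - s.re) = 0 := by linarith
      have := (mul_eq_zero.1 this).resolve_left (by positivity)
      linarith
    have f2 : ‖s‖^2 = x^2+y^2 := by
      rw [hsB, norm_neg, norm_mul] at e2
      have : ‖B‖^2 * (‖s‖^2 - (x^2+y^2)) = 0 := by linarith
      have := (mul_eq_zero.1 this).resolve_left (by positivity)
      linarith
    refine ⟨s, ?_⟩
    rw [key _ (by rw [sph, f1, f2]), hsB]; abel

lemma zero_exists {a : ℕ → H} (ha : SelfMap a) (hnot : ¬ IsBlaschke a 1) {d0 d1 d2 n0 n1 n2 : H}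
    (r : Rep2 a d0 d1 d2 n0 n1 n2) : ∃ p0 : H, ‖p0‖ < 1 ∧ evalC a p0 = 0 := by
  have hd0 : d0 ≠ 0 := by
    have := r.nz 0 (by simp)
    simpa using this
  have ha0 := norm_a0 ha
  by_cases hn : n1 = 0 ∧ n2 = 0
  · exfalso
    obtain ⟨rfl, rfl⟩ := hn
    obtain ⟨h1, h2, h3⟩ := r.c1
    have hd2 : d2 = 0 := by simpa [hd0] using h1
    subst hd2
    have hd1 : d1 = 0 := by simpa [hd0] using h2
    subst hd1
    have h4 := (quad_coeffs r.eq).1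
    rw [← h4] at h3
    simp only [star_zero, mul_zero, add_zero, nsq] at h3
    have h5 : ‖d0‖^2 = ‖d0 * a 0‖^2 := Quaternion.coe_injective h3
    rw [norm_mul] at h5
    have h6 : 0 < ‖d0‖ := by simpa using hd0
    have h7 : ‖d0‖ * ‖a 0‖ < ‖d0‖ := by nlinarith
    have h8 : 0 ≤ ‖d0‖ * ‖a 0‖ := by positivity
    nlinarith
  have hn' : n1 ≠ 0 ∨ n2 ≠ 0 := by tauto
  obtain ⟨s, hs⟩ := fta (n0 := n0) hn'
  by_cases hD : d0 + s * d1 + s * s * d2 = 0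
  · exfalso
    have hs1 : 1 < ‖s‖ := by
      by_contra hc
      exact r.nz s (not_lt.1 hc) hD
    obtain ⟨k0, hk0⟩ : ∃ k0, k0 = d1 + s * d2 := ⟨_, rfl⟩
    obtain ⟨m0, hm0⟩ : ∃ m0, m0 = n1 + s * n2 := ⟨_, rfl⟩
    have b1 : d1 = k0 - s * d2 := by rw [hk0]; abel
    have b2 : n1 = m0 - s * n2 := by rw [hm0]; abel
    have b3 : d0 = -(s * k0) := by
      rw [hk0, eq_neg_iff_add_eq_zero, ← hD, mul_add]; noncomm_ring
    have b4 : n0 = -(s * m0) := by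
      rw [hm0, eq_neg_iff_add_eq_zero, ← hs, mul_add]; noncomm_ring
    obtain ⟨z0, z1⟩ := C1_cancel (s := s) (k0 := k0) (k1 := d2) (m0 := m0) (m1 := n2) (by
      rw [← b1, ← b2, ← b3, ← b4]; exact r.c1)
    have g1 : lin (-s) 1 * lin k0 d2 = quad d0 d1 d2 := by
      rw [lin_mul_lin, b1, b3]; congr 1 <;> simp
      abel
    have g2 : lin (-s) 1 * lin m0 n2 = quad n0 n1 n2 := by
      rw [lin_mul_lin, b2, b4]; congr 1 <;> simp
      abel
    have hE : lin k0 d2 * PowerSeries.mk a = lin m0 n2 := by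
      apply mul_left_cancel₀ (lin_ne_zero (a := -s) (b := 1) (Or.inr one_ne_zero))
      rw [← mul_assoc, g1, g2]; exact r.eq
    have hk : k0 ≠ 0 := by
      rintro h; apply hd0; rw [b3, h]; simp
    have hle : ‖d2‖ ≤ ‖k0‖ := by
      by_contra hc
      push Not at hc
      have hd2 : d2 ≠ 0 := by
        rintro rfl
        simp at hc
        exact absurd hc (not_lt.2 (norm_nonneg _))
      have hd2' : 0 < ‖d2‖ := by simpa using hd2
      obtain ⟨y, hy⟩ : ∃ y, y = -(k0 * d2⁻¹) := ⟨_, rfl⟩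
      have hyn : ‖y‖ < 1 := by
        rw [hy, norm_neg, norm_mul, norm_inv, ← div_eq_mul_inv, div_lt_one hd2']; exact hc
      have hyk : k0 + y * d2 = 0 := by
        rw [hy, neg_mul, mul_assoc, inv_mul_cancel₀ hd2]; simp
      obtain ⟨x, hx, hxy⟩ := exists_s (-s) 1 0 y
      apply r.nz x (by rw [hx]; exact hyn.le)
      simp only [mul_one, mul_zero, add_zero] at hxy
      have : d0 + x * d1 + x * x * d2 = (-s + x) * k0 + x * (-s + x) * d2 := by
        rw [b1, b3]; noncomm_ring
      rw [this, hxy, mul_assoc, ← mul_add, hyk, mul_zero]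
    rcases deg1 hE z0 z1 hk hle with h | ⟨v, hv, h⟩
    · exact hnot h
    · have := congrArg (PowerSeries.coeff 0) h
      simp at this
      rw [this, hv] at ha0
      exact lt_irrefl _ ha0
  · rcases lt_or_ge ‖s‖ 1 with hs1 | hs1
    · have h := eval_quad ha.1 r.eq hs1 hD
      rw [hs] at h
      refine ⟨_, ?_, (mul_eq_zero.1 h.symm).resolve_left hD⟩
      rw [norm_conj hD]; exact hs1
    · exfalso
      obtain ⟨y, hy⟩ : ∃ y, y = (d0 + s * d1 + s * s * d2)⁻¹ * s * (d0 + s * d1 + s * s * d2) := ⟨_, rfl⟩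
      have hyn : ‖y‖ = ‖s‖ := by rw [hy, norm_conj hD]
      have h := C1_root (p := y) r.c1 hs hD (by
        rw [hy, ← mul_assoc, ← mul_assoc, mul_inv_cancel₀ hD, one_mul])
      have hy0 : star y ≠ 0 := by
        rw [← norm_ne_zero_iff, norm_star, hyn]; linarith
      have h' : d0 + d1 * (star y)⁻¹ + d2 * ((star y)⁻¹ * (star y)⁻¹) = 0 := by
        have := congrArg (· * ((star y)⁻¹ * (star y)⁻¹)) h
        simp only [zero_mul, add_mul] at this
        have c1 : d1 * star y * ((star y)⁻¹ * (star y)⁻¹) = d1 * (star y)⁻¹ := by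
          rw [mul_assoc, ← mul_assoc (star y), mul_inv_cancel₀ hy0, one_mul]
        have c2 : d0 * (star y * star y) * ((star y)⁻¹ * (star y)⁻¹) = d0 := by
          rw [mul_assoc, mul_assoc (star y), ← mul_assoc (star y) (star y)⁻¹, mul_inv_cancel₀ hy0, one_mul,
            mul_inv_cancel₀ hy0, mul_one]
        rw [c1, c2] at this
        rw [← this]; abel
      obtain ⟨x, hx, hx0⟩ := right_root h'
      apply r.nz x _ hx0
      rw [hx, norm_inv, norm_star, hyn]
      exact inv_le_one_of_one_le₀ hs1

/-- For a slice regular self-map `f` of `𝔹` which is not a regular Möbius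
transformation times a unimodular constant, `f⋆_p` is a regular Möbius
transformation times a unimodular constant iff `f` is a regular Blaschke
product of degree `2`. -/
theorem hdq_mobius_iff_blaschke_two (a : ℕ → H) (ha : SelfMap a)
    (hnot : ¬ IsBlaschke a 1) (p : H) (hp : ‖p‖ < 1) :
    IsBlaschke (hdqC a p) 1 ↔ IsBlaschke a 2 := by
  constructor
  · intro hb
    obtain ⟨t, u, ht, hu, hg⟩ := (blaschke1_iff _).1 hb
    obtain ⟨d0, d1, d2, n0, n1, n2, r⟩ := rep_exists ha hp ht hu (ha.2 p hp) hg (hdq_eq ha hp)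
    obtain ⟨p0, hp0, h0⟩ := zero_exists ha hnot r
    have hh := hdq_eq ha hp0
    rw [h0] at hh
    simp only [star_zero, map_zero, zero_mul, sub_zero, mul_one] at hh
    obtain ⟨k0, k1, m0, m1, hE, z0, z1, hk, hle⟩ := keyK ha r hp0
    rcases deg1 hE z0 z1 hk hle with h | ⟨v, hv, h⟩
    · exact (blaschke2_iff _).2 ⟨p0, _, hp0, h, hh.symm⟩
    · exact absurd (const_case ha hp0 hv h) hnot
  · intro hb
    obtain ⟨p', g, hp', hg, hE⟩ := (blaschke2_iff _).1 hb
    obtain ⟨t, u, ht, hu, hg'⟩ := (blaschke1_iff _).1 hg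
    obtain ⟨d0, d1, d2, n0, n1, n2, r⟩ := rep_exists ha hp' ht hu (w := 0) (by simp) hg' (by
      simp only [star_zero, map_zero, zero_mul, sub_zero, mul_one]; exact hE.symm)
    obtain ⟨k0, k1, m0, m1, hE, z0, z1, hk, hle⟩ := keyK ha r hp
    rcases deg1 hE z0 z1 hk hle with h | ⟨v, hv, h⟩
    · exact h
    · exact absurd (const_case ha hp hv h) hnot

end QPaper
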